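/- Let n ≥ 1, let m be a natural number, and let U be an open subset of ℝⁿ. Then every morphism of sheaves u : C^m → C^0 over U is a differential operator of order ≤ m with continuous coefficients: there exists a family of continuous functions a_α : U → ℝ, indexed by the multi-indices α with |α| ≤ m, such that for every open V ⊆ U, every φ ∈ C^m(V) and every x ∈ V one has u_V(φ)(x) = Σ_{|α| ≤ m} a_α(x) · (∂^α φ)(x). -/

import Mathlib

open scoped BigOperators

/-- The partial derivative in the `i`-th coordinate direction. -/
noncomputable def pderivE (n : ℕ) (i : Fin n) (f : EuclideanSpace ℝ (Fin n) → ℝ) :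
    EuclideanSpace ℝ (Fin n) → ℝ :=
  fun x => fderiv ℝ f x (EuclideanSpace.single i 1)

/-- The iterated partial derivative `∂^α` for a multi-index `α : Fin n → ℕ`. -/
noncomputable def partialD (n : ℕ) (α : Fin n → ℕ) (f : EuclideanSpace ℝ (Fin n) → ℝ) :
    EuclideanSpace ℝ (Fin n) → ℝ :=
  (List.finRange n).foldr (fun i g => (pderivE n i)^[α i] g) f

/-- The finset of multi-indices `α : Fin n → ℕ` of length `|α| = ∑ i, α i ≤ k`. -/
def multiIdx (n k : ℕ) : Finset (Fin n → ℕ) :=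
  (Finset.Iic fun _ : Fin n => k).filter fun α => (∑ i, α i) ≤ k

/-- A morphism of sheaves `C^m → C^r` over the open set `U ⊆ ℝⁿ`:  a family of
`ℝ`-linear maps `C^m(V) → C^r(V)`, for open `V ⊆ U`, commuting with restriction.
Sections of `C^k` over `V` are represented by total functions that are `C^k` on `V`;
`restrict` encodes both compatibility with restriction and the fact that `app V f`
only depends on `f|_V`. -/
structure SheafHom (n m r : ℕ) (U : Set (EuclideanSpace ℝ (Fin n))) where
  app : Set (EuclideanSpace ℝ (Fin n)) → (EuclideanSpace ℝ (Fin n) → ℝ) →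
    (EuclideanSpace ℝ (Fin n) → ℝ)
  map_contDiffOn : ∀ V, V ⊆ U → IsOpen V → ∀ f, ContDiffOn ℝ (m : ℕ∞) f V →
    ContDiffOn ℝ (r : ℕ∞) (app V f) V
  map_add : ∀ V, V ⊆ U → IsOpen V → ∀ f g, ContDiffOn ℝ (m : ℕ∞) f V →
    ContDiffOn ℝ (m : ℕ∞) g V → ∀ x ∈ V, app V (f + g) x = app V f x + app V g x
  map_smul : ∀ V, V ⊆ U → IsOpen V → ∀ (c : ℝ) f, ContDiffOn ℝ (m : ℕ∞) f V →
    ∀ x ∈ V, app V (c • f) x = c * app V f x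
  restrict : ∀ V, V ⊆ U → IsOpen V → ∀ W, W ⊆ V → IsOpen W →
    ∀ f g, ContDiffOn ℝ (m : ℕ∞) f V → ContDiffOn ℝ (m : ℕ∞) g W →
    (∀ x ∈ W, f x = g x) → ∀ x ∈ W, app V f x = app W g x
open Filter Topology Asymptotics

theorem flat_removable {E : Type} [NormedAddCommGroup E] [NormedSpace ℝ E] (m : ℕ) :
    ∀ {F : Type} [NormedAddCommGroup F] [NormedSpace ℝ F] (f : E → F) (V : Set E) (x0 : E),
    IsOpen V → ContDiffOn ℝ (m : WithTop ℕ∞) f (V \ {x0}) → f x0 = 0 →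
    (∀ k ≤ m, (fun x => iteratedFDeriv ℝ k f x) =o[𝓝[≠] x0] (fun x => ‖x - x0‖ ^ (m - k))) →
    ContDiffOn ℝ (m : WithTop ℕ∞) f V := by
  induction m with
  | zero =>
    intro F _ _ f V x0 hV hf h0 ho
    have hV' : IsOpen (V \ {x0}) := hV.sdiff isClosed_singleton
    have := ho 0 le_rfl
    simp only [Nat.cast_zero, contDiffOn_zero] at hf ⊢
    intro x hx
    by_cases hxx : x = x0
    · subst hxx
      apply ContinuousAt.continuousWithinAt
      rw [continuousAt_iff_punctured_nhds, h0]
      simp only [Nat.sub_self, pow_zero, isLittleO_one_iff] at this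
      rw [tendsto_zero_iff_norm_tendsto_zero] at this ⊢
      simpa using this
    · exact (hf.continuousAt (hV'.mem_nhds ⟨hx, hxx⟩)).continuousWithinAt
  | succ m ih =>
    intro F _ _ f V x0 hV hf h0 ho
    have hV' : IsOpen (V \ {x0}) := hV.sdiff isClosed_singleton
    have h1 : HasFDerivAt f (0 : E →L[ℝ] F) x0 := by
      rw [hasFDerivAt_iff_isLittleO]
      simp only [h0, zero_apply, sub_zero]
      have h2 := ho 0 (Nat.zero_le _)
      have h3 : (fun x => f x) =o[𝓝[≠] x0] (fun x => ‖x - x0‖ ^ (m + 1)) := by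
        rw [← isLittleO_norm_left] at h2 ⊢
        simpa using h2
      have h4 : (fun x => f x) =o[𝓝 x0] (fun x => ‖x - x0‖ ^ (m + 1)) := by
        rw [isLittleO_iff] at h3 ⊢
        intro c hc
        have := h3 hc
        rw [eventually_nhdsWithin_iff] at this
        filter_upwards [this] with x hx
        by_cases hxx : x = x0
        · subst hxx; simp [h0]
        · exact hx hxx
      refine h4.trans_isBigO ?_
      rw [← isBigO_norm_right]
      refine IsBigO.of_bound 1 ?_
      filter_upwards [Metric.ball_mem_nhds x0 one_pos] with x hx
      rw [mem_ball_iff_norm] at hx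
      simp only [norm_pow, norm_norm, one_mul]
      exact pow_le_of_le_one (norm_nonneg _) hx.le (by simp)
    push_cast at hf ⊢
    rw [contDiffOn_succ_iff_fderiv_of_isOpen hV'] at hf
    rw [contDiffOn_succ_iff_fderiv_of_isOpen hV]
    refine ⟨?_, by simp, ?_⟩
    · intro x hx
      by_cases hxx : x = x0
      · subst hxx; exact h1.differentiableAt.differentiableWithinAt
      · exact (hf.1.differentiableAt (hV'.mem_nhds ⟨hx, hxx⟩)).differentiableWithinAt
    · refine ih _ V x0 hV hf.2.2 h1.fderiv ?_
      intro k hk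
      have := ho (k+1) (by omega)
      rw [← isLittleO_norm_left] at this ⊢
      simp only [norm_iteratedFDeriv_fderiv]
      convert this using 3
      omega

theorem flat_bound {E : Type} [NormedAddCommGroup E] [NormedSpace ℝ E] (m : ℕ) :
    ∀ {F : Type} [NormedAddCommGroup F] [NormedSpace ℝ F] (f : E → F) (V : Set E) (x0 : E),
    IsOpen V → x0 ∈ V → ContDiffOn ℝ (m : WithTop ℕ∞) f V → 
    (∀ k ≤ m, iteratedFDeriv ℝ k f x0 = 0) →
    (∀ k ≤ m, (fun x => iteratedFDeriv ℝ k f x) =o[𝓝 x0] (fun x => ‖x - x0‖ ^ (m - k))) := by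
  induction m with
  | zero =>
    intro F _ _ f V x0 hV hx hf h0 k hk
    obtain rfl : k = 0 := by omega
    have hc := hf.continuousOn.continuousAt (hV.mem_nhds hx)
    have h00 := h0 0 le_rfl
    rw [← norm_eq_zero, norm_iteratedFDeriv_zero, norm_eq_zero] at h00
    simp only [Nat.sub_self, pow_zero, isLittleO_one_iff]
    rw [ContinuousAt, h00] at hc
    rw [tendsto_zero_iff_norm_tendsto_zero] at hc ⊢
    simpa using hc
  | succ m ih =>
    intro F _ _ f V x0 hV hx hf h0
    push_cast at hf
    rw [contDiffOn_succ_iff_fderiv_of_isOpen hV] at hf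
    have hI := ih (fderiv ℝ f) V x0 hV hx hf.2.2 (fun k hk => by
      rw [← norm_eq_zero, norm_iteratedFDeriv_fderiv, h0 (k+1) (by omega), norm_zero])
    intro k hk
    rcases k with _ | k
    · have h00 := h0 0 (by omega)
      rw [← norm_eq_zero, norm_iteratedFDeriv_zero, norm_eq_zero] at h00
      have h2 := hI 0 (by omega)
      rw [isLittleO_iff] at h2 ⊢
      intro c hc
      have h3 := h2 hc
      rw [Metric.eventually_nhds_iff_ball] at h3
      obtain ⟨ε, hε, h3⟩ := h3
      obtain ⟨δ, hδ, h4⟩ := Metric.isOpen_iff.1 hV x0 hx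
      filter_upwards [Metric.ball_mem_nhds x0 (lt_min hε hδ)] with x hx
      rw [mem_ball_iff_norm, lt_min_iff] at hx
      have key := Convex.norm_image_sub_le_of_norm_fderiv_le (𝕜 := ℝ) (f := f) (C := c * ‖x - x0‖ ^ m)
        (s := Metric.closedBall x0 ‖x - x0‖) (x := x0) (y := x) ?_ ?_ (convex_closedBall _ _)
        (by simp) (by simp [dist_eq_norm])
      · rw [h00, sub_zero] at key
        simp only [norm_iteratedFDeriv_zero, Nat.sub_zero, norm_pow, norm_norm]
        rw [pow_succ, ← mul_assoc]; exact key
      · intro y hy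
        rw [mem_closedBall_iff_norm] at hy
        refine hf.1.differentiableAt (hV.mem_nhds (h4 ?_))
        rw [mem_ball_iff_norm]; linarith
      · intro y hy
        rw [mem_closedBall_iff_norm] at hy
        have := h3 y (by rw [mem_ball_iff_norm]; linarith)
        simp only [norm_iteratedFDeriv_zero, Nat.sub_zero, norm_pow, norm_norm] at this
        refine this.trans ?_
        gcongr
    · have := hI k (by omega)
      rw [← isLittleO_norm_left] at this ⊢
      simp only [norm_iteratedFDeriv_fderiv] at this
      convert this using 3
      omega

/-- A conical cut-off function. -/
noncomputable def coneCut {E : Type} [NormedAddCommGroup E] [InnerProductSpace ℝ E] (e : E) (x : E) : ℝ :=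
  Real.smoothTransition (2 * inner ℝ x e / ‖x‖)

theorem coneCut_contDiffOn {E : Type} [NormedAddCommGroup E] [InnerProductSpace ℝ E] (e : E) (k : ℕ) :
    ContDiffOn ℝ (k : WithTop ℕ∞) (coneCut e) {0}ᶜ := by
  intro x hx
  have hx : x ≠ 0 := hx
  apply ContDiffAt.contDiffWithinAt
  have h1 : ContDiffAt ℝ (k : WithTop ℕ∞) (fun x : E => 2 * inner ℝ x e / ‖x‖) x := by
    refine ContDiffAt.div (contDiffAt_const.mul (contDiffAt_id.inner ℝ contDiffAt_const))
      (contDiffAt_norm ℝ hx) (norm_ne_zero_iff.2 hx)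
  exact ContDiffAt.comp x (Real.smoothTransition.contDiffAt (n := (k : ℕ∞))) h1

theorem coneCut_smul {E : Type} [NormedAddCommGroup E] [InnerProductSpace ℝ E] (e : E) (t : ℝ) (ht : 0 < t)
    (x : E) : coneCut e (t • x) = coneCut e x := by
  unfold coneCut
  rw [norm_smul, real_inner_smul_left, Real.norm_of_nonneg ht.le]
  congr 1
  by_cases hx : ‖x‖ = 0
  · simp [hx]
  · field_simp

theorem coneCut_bound {E : Type} [NormedAddCommGroup E] [InnerProductSpace ℝ E] [FiniteDimensional ℝ E] (e : E)
    (k : ℕ) : ∃ C : ℝ, 0 ≤ C ∧ ∀ x : E, x ≠ 0 → ‖iteratedFDeriv ℝ k (coneCut e) x‖ * ‖x‖ ^ k ≤ C := by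
  have hc : ContinuousOn (fun x => iteratedFDeriv ℝ k (coneCut e) x) (Metric.sphere (0:E) 1) := by
    intro x hx
    have hx0 : x ≠ 0 := by
      rintro rfl
      simp at hx
    have := (coneCut_contDiffOn e k).contDiffAt (isOpen_compl_singleton.mem_nhds hx0)
    have := this.iteratedFDeriv_right (m := 0) (i := k) (by simp)
    exact this.continuousAt.continuousWithinAt
  obtain ⟨C, hC⟩ := (isCompact_sphere (0:E) 1).exists_bound_of_continuousOn hc
  refine ⟨max C 0, le_max_right _ _, fun x hx => ?_⟩
  have hn : 0 < ‖x‖ := norm_pos_iff.2 hx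
  let t : ℝ := ‖x‖⁻¹
  have ht : 0 < t := inv_pos.2 hn
  let g : E ≃L[ℝ] E := ContinuousLinearEquiv.smulLeft (Units.mk0 t ht.ne')
  have hg : ∀ y, g y = t • y := fun y => rfl
  have hgn : ‖(g : E →L[ℝ] E)‖ ≤ t := by
    refine ContinuousLinearMap.opNorm_le_bound _ ht.le fun y => ?_
    rw [ContinuousLinearEquiv.coe_coe, hg, norm_smul, Real.norm_of_nonneg ht.le]
  have hcomp : coneCut e ∘ g = coneCut e := by
    funext y
    simp only [Function.comp, hg, coneCut_smul e t ht]
  have h1 := g.iteratedFDerivWithin_comp_right (coneCut e) uniqueDiffOn_univ (Set.mem_univ (g x)) k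
  rw [Set.preimage_univ, iteratedFDerivWithin_univ, iteratedFDerivWithin_univ, hcomp] at h1
  rw [h1]
  have h2 := ContinuousMultilinearMap.norm_compContinuousLinearMap_le
    (iteratedFDeriv ℝ k (coneCut e) (g x)) (fun _ : Fin k => (g : E →L[ℝ] E))
  have h3 := hC (g x) (by
    rw [mem_sphere_zero_iff_norm, hg, norm_smul, Real.norm_of_nonneg ht.le]
    exact inv_mul_cancel₀ hn.ne')
  simp only [Finset.prod_const, Finset.card_univ, Fintype.card_fin] at h2
  calc _ ≤ (‖iteratedFDeriv ℝ k (coneCut e) (g x)‖ * ‖(g : E →L[ℝ] E)‖ ^ k) * ‖x‖ ^ k := by gcongr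
    _ ≤ (‖iteratedFDeriv ℝ k (coneCut e) (g x)‖ * t ^ k) * ‖x‖ ^ k := by gcongr
    _ = ‖iteratedFDeriv ℝ k (coneCut e) (g x)‖ := by
      rw [mul_assoc, ← mul_pow, inv_mul_cancel₀ hn.ne', one_pow, mul_one]
    _ ≤ _ := h3.trans (le_max_left _ _)

theorem coneCut_mul_flat {E : Type} [NormedAddCommGroup E] [InnerProductSpace ℝ E] [FiniteDimensional ℝ E]
    (e : E) (m : ℕ) (f : E → ℝ) (V : Set E) (x0 : E)
    (hV : IsOpen V) (hx : x0 ∈ V) (hf : ContDiffOn ℝ (m : WithTop ℕ∞) f V)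
    (h0 : ∀ k ≤ m, iteratedFDeriv ℝ k f x0 = 0) :
    ContDiffOn ℝ (m : WithTop ℕ∞) (fun y => coneCut e (y - x0) * f y) V := by
  have hV' : IsOpen (V \ {x0}) := hV.sdiff isClosed_singleton
  have hχ : ContDiffOn ℝ (m : WithTop ℕ∞) (fun y => coneCut e (y - x0)) (V \ {x0}) := by
    refine (coneCut_contDiffOn e m).comp (contDiff_id.sub contDiff_const).contDiffOn ?_
    intro y hy
    exact sub_ne_zero.2 hy.2
  have hf' := hf.mono (Set.sdiff_subset (t := {x0}))
  have h00 := h0 0 (by omega)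
  rw [← norm_eq_zero, norm_iteratedFDeriv_zero, norm_eq_zero] at h00
  refine flat_removable m _ V x0 hV (hχ.mul hf') (by simp [h00]) ?_
  intro k hk
  have hB := flat_bound m f V x0 hV hx hf h0
  have hsum : (fun x => ∑ i ∈ Finset.range (k + 1), (k.choose i : ℝ) *
      ‖iteratedFDeriv ℝ i (fun y => coneCut e (y - x0)) x‖ * ‖iteratedFDeriv ℝ (k - i) f x‖)
      =o[𝓝[≠] x0] (fun x => ‖x - x0‖ ^ (m - k)) := by
    refine IsLittleO.fun_sum (E' := ℝ) fun i hi => ?_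
    have hi : i ≤ k := by simpa [Nat.lt_succ_iff] using hi
    obtain ⟨C, hC0, hC⟩ := coneCut_bound e i
    have h1 := (hB (k - i) (by omega)).mono (nhdsWithin_le_nhds (s := {x0}ᶜ))
    rw [isLittleO_iff] at h1 ⊢
    intro c hc
    have hpos : 0 < k.choose i * C + 1 := by positivity
    filter_upwards [h1 (div_pos hc hpos), self_mem_nhdsWithin] with x hx hne
    have hne : x - x0 ≠ 0 := sub_ne_zero.2 hne
    have hn : 0 < ‖x - x0‖ := norm_pos_iff.2 hne
    have h2 := hC _ hne
    rw [iteratedFDeriv_comp_sub]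
    simp only [norm_mul, norm_norm, norm_pow, RCLike.norm_natCast] at hx ⊢
    have e1 : m - (k - i) = i + (m - k) := by omega
    rw [e1, pow_add] at hx
    calc _ ≤ (k.choose i : ℝ) * ‖iteratedFDeriv ℝ i (coneCut e) (x - x0)‖ *
          (c / (k.choose i * C + 1) * (‖x - x0‖ ^ i * ‖x - x0‖ ^ (m - k))) := by gcongr
      _ = (k.choose i * (‖iteratedFDeriv ℝ i (coneCut e) (x - x0)‖ * ‖x - x0‖ ^ i)) /
           (k.choose i * C + 1) * (c * ‖x - x0‖ ^ (m - k)) := by ring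
      _ ≤ 1 * (c * ‖x - x0‖ ^ (m - k)) := by
        gcongr
        rw [div_le_one hpos]
        have : (k.choose i : ℝ) * (‖iteratedFDeriv ℝ i (coneCut e) (x - x0)‖ * ‖x - x0‖ ^ i) ≤
          k.choose i * C := by gcongr
        linarith
      _ = _ := one_mul _
  refine IsBigO.trans_isLittleO (IsBigO.of_bound 1 ?_) hsum
  have hmem : V \ {x0} ∈ 𝓝[≠] x0 := by
    rw [Set.sdiff_eq, Set.inter_comm]
    exact inter_mem_nhdsWithin _ (hV.mem_nhds hx)
  filter_upwards [hmem] with x hx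
  have := norm_iteratedFDerivWithin_mul_le hχ hf' hV'.uniqueDiffOn hx (n := k) (by exact_mod_cast hk)
  simp only [iteratedFDerivWithin_of_isOpen _ hV' hx] at this
  rw [one_mul]
  exact this.trans (le_abs_self _)


theorem SheafHom.flat_zero {n m : ℕ} (hn : 1 ≤ n) {U : Set (EuclideanSpace ℝ (Fin n))}
    (u : SheafHom n m 0 U) (V : Set (EuclideanSpace ℝ (Fin n))) (hVU : V ⊆ U) (hV : IsOpen V)
    (f : EuclideanSpace ℝ (Fin n) → ℝ) (hf : ContDiffOn ℝ (m : ℕ∞) f V)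
    (x0 : EuclideanSpace ℝ (Fin n)) (hx0 : x0 ∈ V)
    (h0 : ∀ k ≤ m, iteratedFDeriv ℝ k f x0 = 0) : u.app V f x0 = 0 := by
  set e : EuclideanSpace ℝ (Fin n) := EuclideanSpace.single ⟨0, hn⟩ 1 with he
  have hen : ‖e‖ = 1 := by simp [he]
  set ψ : EuclideanSpace ℝ (Fin n) → ℝ := fun y => coneCut e (y - x0) * f y with hψ
  have hψc : ContDiffOn ℝ (m : ℕ∞) ψ V := coneCut_mul_flat e m f V x0 hV hx0 hf h0
  have hc : ∀ g, ContDiffOn ℝ (m : ℕ∞) g V → ContinuousAt (u.app V g) x0 := fun g hg =>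
    (u.map_contDiffOn V hVU hV g hg).continuousOn.continuousAt (hV.mem_nhds hx0)
  have hz : ContDiffOn ℝ (m : ℕ∞) (0 : EuclideanSpace ℝ (Fin n) → ℝ) V := contDiffOn_const
  have hu0 : u.app V 0 x0 = 0 := by
    have := u.map_smul V hVU hV 0 0 hz x0 hx0
    simpa using this
  -- agreement on an open set accumulating at `x0`
  have agree : ∀ (g h : EuclideanSpace ℝ (Fin n) → ℝ) (A : Set (EuclideanSpace ℝ (Fin n)))
      (v : EuclideanSpace ℝ (Fin n)),
      ContDiffOn ℝ (m : ℕ∞) g V → ContDiffOn ℝ (m : ℕ∞) h V → IsOpen A →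
      (∀ s : ℝ, 0 < s → x0 + s • v ∈ A) → (∀ y ∈ A, g y = h y) →
      u.app V g x0 = u.app V h x0 := by
    intro g h A v hg hh hA hv hgh
    have hVA : IsOpen (V ∩ A) := hV.inter hA
    have hto : Tendsto (fun s : ℝ => x0 + s • v) (𝓝[>] 0) (𝓝 x0) := by
      have : Continuous (fun s : ℝ => x0 + s • v) := by fun_prop
      have := this.tendsto 0
      simp only [zero_smul, add_zero] at this
      exact this.mono_left nhdsWithin_le_nhds
    refine tendsto_nhds_unique_of_eventuallyEq ((hc g hg).tendsto.comp hto)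
      ((hc h hh).tendsto.comp hto) ?_
    filter_upwards [hto (hV.mem_nhds hx0), self_mem_nhdsWithin] with s hs1 hs2
    have hmem : x0 + s • v ∈ V ∩ A := ⟨hs1, hv s hs2⟩
    have hh' := hh.mono (Set.inter_subset_left (t := A))
    simp only [Function.comp]
    rw [u.restrict V hVU hV (V ∩ A) Set.inter_subset_left hVA g h hg hh' (fun y hy => hgh y hy.2) _ hmem,
      u.restrict V hVU hV (V ∩ A) Set.inter_subset_left hVA h h hh hh' (fun y hy => rfl) _ hmem]
  have h1 : u.app V ψ x0 = u.app V f x0 := by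
    refine agree ψ f {y | ‖y - x0‖ < 2 * inner ℝ (y - x0) e} e hψc hf ?_ ?_ ?_
    · exact isOpen_lt (by fun_prop) (by fun_prop)
    · intro s hs
      simp only [Set.mem_ofPred_eq, add_sub_cancel_left, norm_smul, real_inner_smul_left,
        real_inner_self_eq_norm_sq, hen, Real.norm_of_nonneg hs.le]
      linarith
    · intro y hy
      have hy : ‖y - x0‖ < 2 * inner ℝ (y - x0) e := hy
      have : coneCut e (y - x0) = 1 := by
        apply Real.smoothTransition.one_of_one_le
        have : 0 < ‖y - x0‖ := by
          rw [norm_pos_iff]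
          intro h
          simp [h] at hy
        rw [le_div_iff₀ this]; linarith
      simp [hψ, this]
  have h2 : u.app V ψ x0 = u.app V 0 x0 := by
    refine agree ψ 0 {y | inner ℝ (y - x0) e < 0} (-e) hψc hz ?_ ?_ ?_
    · exact isOpen_lt (by fun_prop) (by fun_prop)
    · intro s hs
      simp only [Set.mem_ofPred_eq, add_sub_cancel_left, real_inner_smul_left, inner_neg_left,
        real_inner_self_eq_norm_sq, hen]
      linarith
    · intro y hy
      have hy : inner ℝ (y - x0) e < 0 := hy
      have : coneCut e (y - x0) = 0 := by
        apply Real.smoothTransition.zero_of_nonpos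
        apply div_nonpos_of_nonpos_of_nonneg (by linarith) (norm_nonneg _)
      simp [hψ, this]
  rw [← h1, h2, hu0]

/-- Iterated partial derivatives along a list of coordinates. -/
noncomputable def listD (n : ℕ) (l : List (Fin n)) (f : EuclideanSpace ℝ (Fin n) → ℝ) :
    EuclideanSpace ℝ (Fin n) → ℝ := l.foldr (pderivE n) f

/-- The list of coordinates attached to a multi-index. -/
def idxList (n : ℕ) (α : Fin n → ℕ) : List (Fin n) :=
  (List.finRange n).flatMap fun i => List.replicate (α i) i

theorem partialD_eq_listD (n : ℕ) (α : Fin n → ℕ) (f : EuclideanSpace ℝ (Fin n) → ℝ) :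
    partialD n α f = listD n (idxList n α) f := by
  unfold partialD listD idxList
  induction List.finRange n with
  | nil => rfl
  | cons i L ih =>
    rw [List.foldr_cons, ih, List.flatMap_cons, List.foldr_append]
    generalize List.foldr (pderivE n) f _ = g
    induction α i with
    | zero => rfl
    | succ k ihk => rw [Function.iterate_succ_apply', ihk, List.replicate_succ, List.foldr_cons]

theorem idxList_count (n : ℕ) (α : Fin n → ℕ) (j : Fin n) : (idxList n α).count j = α j := by
  unfold idxList
  rw [List.count_flatMap]
  have : (List.count j ∘ fun i => List.replicate (α i) i) = fun i => if i = j then α i else 0 := by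
    funext i
    simp [List.count_replicate]
  rw [this, ← List.ofFn_eq_map, List.sum_ofFn]
  simp

theorem idxList_length (n : ℕ) (α : Fin n → ℕ) : (idxList n α).length = ∑ i, α i := by
  unfold idxList
  rw [List.length_flatMap]
  simp only [List.length_replicate]
  rw [← List.ofFn_eq_map, List.sum_ofFn]

theorem mem_multiIdx (n k : ℕ) (α : Fin n → ℕ) : α ∈ multiIdx n k ↔ ∑ i, α i ≤ k := by
  unfold multiIdx
  simp only [Finset.mem_filter, Finset.mem_Iic, and_iff_right_iff_imp]
  intro h i
  exact (Finset.single_le_sum (fun _ _ => Nat.zero_le _) (Finset.mem_univ i)).trans h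

theorem pderivE_congr {n : ℕ} {V : Set (EuclideanSpace ℝ (Fin n))} (hV : IsOpen V) (i : Fin n)
    {f g : EuclideanSpace ℝ (Fin n) → ℝ} (h : Set.EqOn f g V) :
    Set.EqOn (pderivE n i f) (pderivE n i g) V := by
  intro x hx
  unfold pderivE
  rw [(h.eventuallyEq_of_mem (hV.mem_nhds hx)).fderiv_eq]

theorem pderivE_contDiffOn {n : ℕ} {V : Set (EuclideanSpace ℝ (Fin n))} (hV : IsOpen V) (i : Fin n)
    {f : EuclideanSpace ℝ (Fin n) → ℝ} (k : ℕ) (hf : ContDiffOn ℝ ((k + 1 : ℕ) : WithTop ℕ∞) f V) :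
    ContDiffOn ℝ (k : WithTop ℕ∞) (pderivE n i f) V := by
  push_cast at hf
  rw [contDiffOn_succ_iff_fderiv_of_isOpen hV] at hf
  exact hf.2.2.clm_apply contDiffOn_const

theorem listD_contDiffOn {n : ℕ} {V : Set (EuclideanSpace ℝ (Fin n))} (hV : IsOpen V)
    (l : List (Fin n)) : ∀ {f : EuclideanSpace ℝ (Fin n) → ℝ} (k : ℕ),
    ContDiffOn ℝ ((k + l.length : ℕ) : WithTop ℕ∞) f V →
    ContDiffOn ℝ (k : WithTop ℕ∞) (listD n l f) V := by
  induction l with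
  | nil => intro f k hf; simpa [listD] using hf
  | cons i l ih =>
    intro f k hf
    refine pderivE_contDiffOn hV i k (ih (k + 1) ?_)
    rw [List.length_cons] at hf
    rwa [show k + 1 + l.length = k + (l.length + 1) by omega]

theorem pderivE_comm {n : ℕ} {V : Set (EuclideanSpace ℝ (Fin n))} (hV : IsOpen V) (i j : Fin n)
    {f : EuclideanSpace ℝ (Fin n) → ℝ} (hf : ContDiffOn ℝ ((2 : ℕ) : WithTop ℕ∞) f V) :
    Set.EqOn (pderivE n i (pderivE n j f)) (pderivE n j (pderivE n i f)) V := by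
  intro x hx
  have hfx := hf.contDiffAt (hV.mem_nhds hx)
  have hs : IsSymmSndFDerivAt ℝ f x := hfx.isSymmSndFDerivAt (by simp)
  have hd : DifferentiableAt ℝ (fderiv ℝ f) x := by
    have : ContDiffAt ℝ 1 (fderiv ℝ f) x := hfx.fderiv_right (by norm_num)
    exact this.differentiableAt (by norm_num)
  have key : ∀ a b : Fin n, pderivE n a (pderivE n b f) x =
      fderiv ℝ (fderiv ℝ f) x (EuclideanSpace.single a 1) (EuclideanSpace.single b 1) := by
    intro a b
    unfold pderivE
    rw [fderiv_clm_apply hd (differentiableAt_const _)]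
    simp
  rw [key, key]
  exact hs _ _

theorem listD_perm {n : ℕ} {V : Set (EuclideanSpace ℝ (Fin n))} (hV : IsOpen V)
    {f : EuclideanSpace ℝ (Fin n) → ℝ} {l l' : List (Fin n)} (h : l.Perm l') :
    ContDiffOn ℝ (l.length : WithTop ℕ∞) f V → Set.EqOn (listD n l f) (listD n l' f) V := by
  induction h with
  | nil => intro _ x _; rfl
  | cons i h ih =>
    intro hf
    refine pderivE_congr hV i (ih (hf.of_le ?_))
    simp only [List.length_cons]
    exact_mod_cast Nat.le_succ _
  | swap i j l =>
    intro hf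
    refine pderivE_comm hV j i (listD_contDiffOn hV l 2 ?_)
    simp only [List.length_cons] at hf
    rwa [show 2 + l.length = l.length + 1 + 1 by omega]
  | trans h1 h2 ih1 ih2 =>
    intro hf
    exact (ih1 hf).trans (ih2 (by rwa [← h1.length_eq]))

theorem listD_eq_iteratedFDeriv {n : ℕ} {V : Set (EuclideanSpace ℝ (Fin n))} (hV : IsOpen V)
    {f : EuclideanSpace ℝ (Fin n) → ℝ} (l : List (Fin n)) :
    ContDiffOn ℝ (l.length : WithTop ℕ∞) f V → ∀ x ∈ V, listD n l f x =
      iteratedFDeriv ℝ l.length f x (fun j => EuclideanSpace.single (l.get j) (1 : ℝ)) := by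
  induction l with
  | nil => intro _ x _; simp [listD]
  | cons i l ih =>
    intro hf x hx
    have h1 : Set.EqOn (listD n l f) (fun x => iteratedFDeriv ℝ l.length f x
        (fun j => EuclideanSpace.single (l.get j) (1 : ℝ))) V :=
      ih (hf.of_le (by simp only [List.length_cons]; exact_mod_cast Nat.le_succ _))
    have h2 := pderivE_congr hV i h1 hx
    have hfx := hf.contDiffAt (hV.mem_nhds hx)
    have hd : DifferentiableAt ℝ (iteratedFDeriv ℝ l.length f) x := by
      have : ContDiffAt ℝ 1 (iteratedFDeriv ℝ l.length f) x :=
        hfx.iteratedFDeriv_right (by simp only [List.length_cons]; push_cast; rw [add_comm])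
      exact this.differentiableAt (by norm_num)
    change pderivE n i (listD n l f) x = _
    rw [h2]
    unfold pderivE
    let L := ContinuousMultilinearMap.apply ℝ (fun _ : Fin l.length => EuclideanSpace ℝ (Fin n)) ℝ
      (fun j => EuclideanSpace.single (l.get j) (1 : ℝ))
    have h3 := (L.hasFDerivAt.comp x hd.hasFDerivAt).fderiv
    have h4 : fderiv ℝ (fun x => iteratedFDeriv ℝ l.length f x
        (fun j => EuclideanSpace.single (l.get j) (1 : ℝ))) x =
        L.comp (fderiv ℝ (iteratedFDeriv ℝ l.length f) x) := h3
    rw [h4]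
    rfl

theorem flat_of_partialD {n m : ℕ} {V : Set (EuclideanSpace ℝ (Fin n))} (hV : IsOpen V)
    {f : EuclideanSpace ℝ (Fin n) → ℝ} (hf : ContDiffOn ℝ (m : WithTop ℕ∞) f V)
    (x : EuclideanSpace ℝ (Fin n)) (hx : x ∈ V)
    (h0 : ∀ α ∈ multiIdx n m, partialD n α f x = 0) : ∀ k ≤ m, iteratedFDeriv ℝ k f x = 0 := by
  intro k hk
  apply ContinuousMultilinearMap.toMultilinearMap_injective
  refine Module.Basis.ext_multilinear (fun _ => (EuclideanSpace.basisFun (Fin n) ℝ).toBasis) fun v => ?_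
  obtain ⟨l, hl, hv⟩ : ∃ l : List (Fin n), ∃ h : l.length = k, ∀ j : Fin k, v j = l.get (j.cast h.symm) :=
    ⟨List.ofFn v, List.length_ofFn, fun j => by simp⟩
  subst hl
  obtain rfl : v = l.get := funext hv
  have hlc : ContDiffOn ℝ (l.length : WithTop ℕ∞) f V := hf.of_le (by exact_mod_cast hk)
  have h1 := listD_eq_iteratedFDeriv hV l hlc x hx
  have hp : l.Perm (idxList n (fun j => l.count j)) := by
    rw [List.perm_iff_count]
    intro j
    rw [idxList_count]
  have h2 := listD_perm hV hp hlc hx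
  have h3 := h0 (fun j => l.count j) (by
    rw [mem_multiIdx, ← idxList_length, ← hp.length_eq]; exact hk)
  rw [partialD_eq_listD, ← h2, h1] at h3
  simpa using h3

theorem partialD_eq_iteratedFDeriv {n m : ℕ} {V : Set (EuclideanSpace ℝ (Fin n))} (hV : IsOpen V)
    {f : EuclideanSpace ℝ (Fin n) → ℝ} (hf : ContDiffOn ℝ (m : WithTop ℕ∞) f V)
    (x : EuclideanSpace ℝ (Fin n)) (hx : x ∈ V) (α : Fin n → ℕ) (hα : α ∈ multiIdx n m) :
    partialD n α f x = iteratedFDeriv ℝ (idxList n α).length f x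
      (fun j => EuclideanSpace.single ((idxList n α).get j) (1 : ℝ)) := by
  rw [partialD_eq_listD]
  refine listD_eq_iteratedFDeriv hV _ (hf.of_le ?_) x hx
  rw [mem_multiIdx, ← idxList_length] at hα
  exact_mod_cast hα

/-- Products of functions of one variable. -/
noncomputable def prodFn {n : ℕ} (g : Fin n → ℝ → ℝ) (y : EuclideanSpace ℝ (Fin n)) : ℝ := ∏ j, g j (y j)

theorem pderivE_prodFn {n : ℕ} (g : Fin n → ℝ → ℝ) (hg : ∀ j, Differentiable ℝ (g j)) (i : Fin n) :
    pderivE n i (prodFn g) = prodFn (Function.update g i (deriv (g i))) := by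
  funext y
  unfold pderivE prodFn
  have h1 : ∀ j ∈ Finset.univ, HasFDerivAt (fun y : EuclideanSpace ℝ (Fin n) => g j (y j))
      ((deriv (g j) (y j)) • (EuclideanSpace.proj j : EuclideanSpace ℝ (Fin n) →L[ℝ] ℝ)) y := by
    intro j _
    exact ((hg j (y j)).hasDerivAt).comp_hasFDerivAt y
      (EuclideanSpace.proj j : EuclideanSpace ℝ (Fin n) →L[ℝ] ℝ).hasFDerivAt
  have h2 := HasFDerivAt.finsetProd h1
  rw [h2.fderiv]
  have hp : ∀ j, (EuclideanSpace.proj j : EuclideanSpace ℝ (Fin n) →L[ℝ] ℝ)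
      (EuclideanSpace.single i (1 : ℝ)) = if j = i then 1 else 0 := by
    intro j
    simp [Pi.single_apply]
  simp only [sum_apply, smul_apply, hp, smul_eq_mul]
  rw [Finset.sum_eq_single i]
  · rw [← Finset.mul_prod_erase _ _ (Finset.mem_univ i)]
    simp only [Function.update_self, if_true, mul_one]
    rw [mul_comm]
    congr 1
    refine Finset.prod_congr rfl fun j hj => ?_
    rw [Function.update_of_ne (Finset.ne_of_mem_erase hj)]
  · intro j _ hj
    simp [hj]
  · simp

theorem iter_deriv_sub_pow (c : ℝ) (a k : ℕ) :
    deriv^[k] (fun t : ℝ => (t - c) ^ a) = fun t => (a.descFactorial k : ℝ) * (t - c) ^ (a - k) := by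
  induction k with
  | zero => simp
  | succ k ih =>
    rw [Function.iterate_succ_apply', ih]
    funext t
    have : HasDerivAt (fun t : ℝ => (a.descFactorial k : ℝ) * (t - c) ^ (a - k))
      ((a.descFactorial k : ℝ) * (((a - k : ℕ) : ℝ) * (t - c) ^ (a - k - 1) * 1)) t :=
      (((hasDerivAt_id t).sub_const c).pow (a - k)).const_mul _
    rw [this.deriv, Nat.descFactorial_succ, Nat.sub_sub]
    push_cast
    ring

/-- Centered monomials. -/
noncomputable def monoFn {n : ℕ} (x : EuclideanSpace ℝ (Fin n)) (α : Fin n → ℕ) :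
    EuclideanSpace ℝ (Fin n) → ℝ := prodFn fun j t => (t - x j) ^ α j

theorem iter_pderivE_prodFn {n : ℕ} (g : Fin n → ℝ → ℝ) (hg : ∀ j k, Differentiable ℝ (deriv^[k] (g j)))
    (i : Fin n) (k : ℕ) :
    (pderivE n i)^[k] (prodFn g) = prodFn (Function.update g i (deriv^[k] (g i))) := by
  induction k with
  | zero => simp
  | succ k ih =>
    rw [Function.iterate_succ_apply', ih, pderivE_prodFn]
    · simp only [Function.update_idem, Function.update_self, Function.iterate_succ_apply']
    · intro j
      by_cases hj : j = i
      · subst hj; simpa using hg j k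
      · simpa [hj] using hg j 0

theorem partialD_prodFn {n : ℕ} (g : Fin n → ℝ → ℝ) (hg : ∀ j k, Differentiable ℝ (deriv^[k] (g j)))
    (β : Fin n → ℕ) : partialD n β (prodFn g) = prodFn (fun j => deriv^[β j] (g j)) := by
  have key : ∀ L : List (Fin n), L.Nodup → L.foldr (fun i g => (pderivE n i)^[β i] g) (prodFn g) =
      prodFn (fun j => if j ∈ L then deriv^[β j] (g j) else g j) := by
    intro L hL
    induction L with
    | nil => simp
    | cons i L ih =>
      rw [List.nodup_cons] at hL
      rw [List.foldr_cons, ih hL.2, iter_pderivE_prodFn]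
      · congr 1
        funext j
        by_cases hj : j = i
        · subst hj; simp [hL.1]
        · simp [hj]
      · intro j k
        by_cases hj : j ∈ L
        · simp only [hj, if_true]
          rw [← Function.iterate_add_apply]
          exact hg _ _
        · simp only [hj, if_false]
          exact hg _ _
  unfold partialD
  rw [key _ (List.nodup_finRange n)]
  simp

theorem partialD_monoFn {n : ℕ} (x : EuclideanSpace ℝ (Fin n)) (α β : Fin n → ℕ) :
    partialD n β (monoFn x α) x = if α = β then ((∏ j, (α j).factorial : ℕ) : ℝ) else 0 := by
  unfold monoFn
  rw [partialD_prodFn]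
  · simp only [iter_deriv_sub_pow, prodFn, sub_self]
    split_ifs with h
    · subst h; simp [Nat.descFactorial_self]
    · obtain ⟨j, hj⟩ := Function.ne_iff.1 h
      refine Finset.prod_eq_zero (Finset.mem_univ j) ?_
      rcases lt_or_gt_of_ne hj with h | h
      · simp [Nat.descFactorial_eq_zero_iff_lt.2 h]
      · simp [zero_pow (Nat.sub_ne_zero_of_lt h)]
  · intro j k
    rw [iter_deriv_sub_pow]
    fun_prop

theorem monoFn_contDiff {n : ℕ} (x : EuclideanSpace ℝ (Fin n)) (α : Fin n → ℕ) (k : WithTop ℕ∞) :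
    ContDiff ℝ k (monoFn x α) := by
  unfold monoFn prodFn
  fun_prop

theorem monoFn_expand {n : ℕ} (x : EuclideanSpace ℝ (Fin n)) (α : Fin n → ℕ) :
    monoFn x α = ∑ p ∈ Fintype.piFinset (fun j => Finset.range (α j + 1)),
      (∏ j, (-x j) ^ (α j - p j) * ((α j).choose (p j) : ℝ)) • monoFn 0 p := by
  funext y
  simp only [Finset.sum_apply, Pi.smul_apply, smul_eq_mul, monoFn, prodFn]
  have : ∀ j, (y j - x j) ^ α j = ∑ k ∈ Finset.range (α j + 1),
      y j ^ k * (-x j) ^ (α j - k) * ((α j).choose k : ℝ) := by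
    intro j
    rw [sub_eq_add_neg, add_pow]
  simp only [this]
  rw [Finset.prod_univ_sum]
  refine Finset.sum_congr rfl fun p _ => ?_
  rw [← Finset.prod_mul_distrib]
  refine Finset.prod_congr rfl fun j _ => ?_
  simp
  ring

theorem SheafHom.map_sum {n m r : ℕ} {U : Set (EuclideanSpace ℝ (Fin n))}
    (u : SheafHom n m r U) (V : Set (EuclideanSpace ℝ (Fin n))) (hVU : V ⊆ U) (hV : IsOpen V)
    {ι : Type} (s : Finset ι) (c : ι → ℝ) (M : ι → EuclideanSpace ℝ (Fin n) → ℝ)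
    (hM : ∀ i, ContDiff ℝ (m : ℕ∞) (M i)) (x : EuclideanSpace ℝ (Fin n)) (hx : x ∈ V) :
    u.app V (∑ i ∈ s, c i • M i) x = ∑ i ∈ s, c i * u.app V (M i) x := by
  classical
  induction s using Finset.induction_on with
  | empty =>
    have := u.map_smul V hVU hV 0 0 contDiffOn_const x hx
    simpa using this
  | insert i s hi ih =>
    rw [Finset.sum_insert hi, Finset.sum_insert hi, u.map_add V hVU hV, ih,
      u.map_smul V hVU hV _ _ (hM i).contDiffOn x hx]
    · exact ((hM i).const_smul (c i)).contDiffOn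
    · have : ContDiff ℝ (m : ℕ∞) (fun y => ∑ i ∈ s, (c i • M i) y) :=
        ContDiff.sum fun i _ => (hM i).const_smul (c i)
      convert this.contDiffOn using 1
      funext y
      simp
    · exact hx

/-- Every morphism of sheaves `u : C^m → C^0` over an open `U ⊆ ℝⁿ` is a differential
operator of order `≤ m` with continuous coefficients. -/
theorem stmt_3 (n m : ℕ) (hn : 1 ≤ n)
    (U : Set (EuclideanSpace ℝ (Fin n))) (hU : IsOpen U)
    (u : SheafHom n m 0 U) :
    ∃ a : (Fin n → ℕ) → EuclideanSpace ℝ (Fin n) → ℝ,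
      (∀ α ∈ multiIdx n m, ContinuousOn (a α) U) ∧
      ∀ V, V ⊆ U → IsOpen V → ∀ φ, ContDiffOn ℝ (m : ℕ∞) φ V → ∀ x ∈ V,
        u.app V φ x = ∑ α ∈ multiIdx n m, a α x * partialD n α φ x := by
  refine ⟨fun α x => u.app U (monoFn x α) x / ((∏ j, (α j).factorial : ℕ) : ℝ), ?_, ?_⟩
  · intro α _
    refine ContinuousOn.div_const ?_ _
    have hcongr : ∀ x ∈ U, u.app U (monoFn x α) x =
        ∑ p ∈ Fintype.piFinset (fun j => Finset.range (α j + 1)),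
          (∏ j, (-x j) ^ (α j - p j) * ((α j).choose (p j) : ℝ)) * u.app U (monoFn 0 p) x := by
      intro x hx
      rw [monoFn_expand]
      exact u.map_sum U subset_rfl hU _ _ _ (fun p => monoFn_contDiff 0 p _) x hx
    refine ContinuousOn.congr ?_ hcongr
    refine continuousOn_finsetSum _ fun p _ => ContinuousOn.mul ?_ ?_
    · apply Continuous.continuousOn
      fun_prop
    · exact (u.map_contDiffOn U subset_rfl hU _ (monoFn_contDiff 0 p _).contDiffOn).continuousOn
  · intro V hVU hV φ hφ x hx
    set c : (Fin n → ℕ) → ℝ := fun α => partialD n α φ x / ((∏ j, (α j).factorial : ℕ) : ℝ) with hc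
    set T : EuclideanSpace ℝ (Fin n) → ℝ := ∑ α ∈ multiIdx n m, c α • monoFn x α with hT
    have hTc : ∀ k : WithTop ℕ∞, ContDiff ℝ k T := by
      intro k
      have : ContDiff ℝ k (fun y => ∑ α ∈ multiIdx n m, (c α • monoFn x α) y) :=
        ContDiff.sum fun i _ => (monoFn_contDiff x i k).const_smul (c i)
      convert this using 1
      funext y
      simp [hT]
    have hR : ContDiffOn ℝ (m : ℕ∞) (φ + (-1 : ℝ) • T) V :=
      hφ.add ((hTc _).const_smul (-1 : ℝ)).contDiffOn
    have hflat : ∀ k ≤ m, iteratedFDeriv ℝ k (φ + (-1 : ℝ) • T) x = 0 := by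
      refine flat_of_partialD hV hR x hx fun α hα => ?_
      have hlen : (idxList n α).length ≤ m := by rwa [idxList_length, ← mem_multiIdx]
      have hφx : ContDiffAt ℝ ((idxList n α).length : WithTop ℕ∞) φ x :=
        (hφ.contDiffAt (hV.mem_nhds hx)).of_le (by exact_mod_cast hlen)
      have hTx : partialD n α T x = partialD n α φ x := by
        rw [partialD_eq_iteratedFDeriv hV (hTc m).contDiffOn x hx α hα, hT,
          iteratedFDeriv_sum_apply (f := fun β => c β • monoFn x β)
            (fun β _ => ((monoFn_contDiff x β _).const_smul (c β)).contDiffAt)]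
        have : ∀ β, iteratedFDeriv ℝ (idxList n α).length (c β • monoFn x β) x
            (fun j => EuclideanSpace.single ((idxList n α).get j) (1 : ℝ)) =
            c β * (if β = α then ((∏ j, (β j).factorial : ℕ) : ℝ) else 0) := by
          intro β
          rw [iteratedFDeriv_const_smul_apply (monoFn_contDiff x β _).contDiffAt,
            ContinuousMultilinearMap.smul_apply,
            ← partialD_eq_iteratedFDeriv hV (monoFn_contDiff x β m).contDiffOn x hx α hα,
            partialD_monoFn, smul_eq_mul]
        rw [ContinuousMultilinearMap.sum_apply]
        simp only [this, mul_ite, mul_zero]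
        rw [Finset.sum_ite_eq' _ _ _, if_pos hα]
        have hne : ((∏ j, (α j).factorial : ℕ) : ℝ) ≠ 0 := by
          exact_mod_cast (Finset.prod_ne_zero_iff.2 fun j _ => Nat.factorial_ne_zero _)
        rw [hc]
        exact div_mul_cancel₀ _ hne
      rw [partialD_eq_iteratedFDeriv hV hR x hx α hα,
        iteratedFDeriv_add_apply (g := (-1 : ℝ) • T) hφx ((hTc _).const_smul (-1 : ℝ)).contDiffAt,
        iteratedFDeriv_const_smul_apply (hTc _).contDiffAt, ContinuousMultilinearMap.add_apply,
        ContinuousMultilinearMap.smul_apply,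
        ← partialD_eq_iteratedFDeriv hV hφ x hx α hα,
        ← partialD_eq_iteratedFDeriv hV (hTc m).contDiffOn x hx α hα, hTx]
      simp
    have h0 := u.flat_zero hn V hVU hV _ hR x hx hflat
    have hsplit : φ = (φ + (-1 : ℝ) • T) + T := by
      funext y
      simp
    rw [hsplit, u.map_add V hVU hV _ _ hR (hTc _).contDiffOn x hx, h0, zero_add, ← hsplit, hT,
      u.map_sum V hVU hV _ _ _ (fun p => monoFn_contDiff x p _) x hx]
    refine Finset.sum_congr rfl fun α _ => ?_
    beta_reduce
    rw [u.restrict U subset_rfl hU V hVU hV (monoFn x α) (monoFn x α)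
      (monoFn_contDiff x α _).contDiffOn (monoFn_contDiff x α _).contDiffOn (fun _ _ => rfl) x hx, hc]
    ring
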